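/- arXiv:2005.03269 — 5 statements merged into one kernel-verified Lean document; each statement's English description precedes it below -/
import Mathlib

section
/- If N = 2m for some integer m ≥ 1, then Θ^{*s}(μ,x) ≤ (NR)^{-s} for every x ∈ E. -/
open MeasureTheory Filter Set Topology ENNReal

namespace HomogeneousCantorDensity

noncomputable def R (N : ℕ) (ρ : ℝ) : ℝ := (1 - ρ) / ((N : ℝ) - 1)

noncomputable def f (N : ℕ) (ρ : ℝ) (i : ℕ) (x : ℝ) : ℝ := ρ * x + (i : ℝ) * R N ρ

noncomputable def piMap (N : ℕ) (ρ : ℝ) (d : ℕ → ℕ) : ℝ :=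
  R N ρ * ∑' i : ℕ, (d i : ℝ) * ρ ^ i

def cantorE (N : ℕ) (ρ : ℝ) : Set ℝ :=
  {x | ∃ d : ℕ → ℕ, (∀ i, d i < N) ∧ x = piMap N ρ d}

/-- `μ = ∑_{i=0}^{N-1} (1/N) μ ∘ f_i⁻¹`. -/
def IsSelfSimilar (N : ℕ) (ρ : ℝ) (μ : Measure ℝ) : Prop :=
  μ = ∑ i ∈ Finset.range N, (N : ℝ≥0∞)⁻¹ • μ.map (f N ρ i)

/-- `T^n x` for `x = piMap N ρ d`. -/
noncomputable def Tn (N : ℕ) (ρ : ℝ) (d : ℕ → ℕ) (n : ℕ) : ℝ :=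
  piMap N ρ (fun i => d (n + i))

/-- pointwise lower `s`-density of `μ` at `x`. -/
noncomputable def lowerDensity (μ : Measure ℝ) (s x : ℝ) : ℝ :=
  liminf (fun r : ℝ => (μ (Ioo (x - r) (x + r))).toReal / (2 * r) ^ s) (𝓝[>] 0)

/-- pointwise upper `s`-density of `μ` at `x`. -/
noncomputable def upperDensity (μ : Measure ℝ) (s x : ℝ) : ℝ :=
  limsup (fun r : ℝ => (μ (Ioo (x - r) (x + r))).toReal / (2 * r) ^ s) (𝓝[>] 0)

/-- Reals form of self similarity. -/
theorem ss_real {N : ℕ} {ρ : ℝ} {μ : Measure ℝ} [IsProbabilityMeasure μ]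
    (hss : IsSelfSimilar N ρ μ) (hN : 2 ≤ N) {A : Set ℝ} (hA : MeasurableSet A) :
    (N : ℝ) * μ.real A = ∑ i ∈ Finset.range N, μ.real (f N ρ i ⁻¹' A) := by
  have hN0 : (N : ℝ) ≠ 0 := by positivity
  have hf : ∀ i, Measurable (f N ρ i) := fun i => by unfold f; fun_prop
  have h : μ A = ∑ i ∈ Finset.range N, (N : ℝ≥0∞)⁻¹ * μ (f N ρ i ⁻¹' A) := by
    conv_lhs => rw [hss]
    rw [Measure.finsetSum_apply]
    refine Finset.sum_congr rfl fun i _ => ?_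
    rw [Measure.smul_apply, Measure.map_apply (hf i) hA, smul_eq_mul]
  have h2 : μ.real A = ∑ i ∈ Finset.range N, (N : ℝ)⁻¹ * μ.real (f N ρ i ⁻¹' A) := by
    rw [Measure.real, h, ENNReal.toReal_sum]
    · refine Finset.sum_congr rfl fun i _ => ?_
      simp [Measure.real]
    · intro i _
      refine ENNReal.mul_ne_top ?_ (measure_ne_top _ _)
      simp; omega
  rw [h2, ← Finset.mul_sum, ← mul_assoc, mul_inv_cancel₀ hN0, one_mul]

/-- Numerical facts. -/
theorem basic {N : ℕ} {ρ : ℝ} (hN : 2 ≤ N) (hρ0 : 0 < ρ) (hρ1 : ρ ≤ 1 / (N : ℝ) ^ 2) :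
    (2 : ℝ) ≤ N ∧ 2 * N * ρ ≤ 2 / N ∧ 2 * N * ρ ≤ 1 ∧ 1 ≤ N * R N ρ ∧ 0 < R N ρ ∧ ρ < R N ρ ∧
      2 * ρ ≤ R N ρ ∧
      ((N : ℝ) - 1) * R N ρ = 1 - ρ ∧ 1 < N * R N ρ ∧ ρ * N ^ 2 ≤ 1 := by
  have h2 : (2 : ℝ) ≤ N := by exact_mod_cast hN
  have h1 : ρ * N ^ 2 ≤ 1 := by
    rwa [le_div_iff₀ (by positivity)] at hρ1
  have hR : ((N : ℝ) - 1) * R N ρ = 1 - ρ := by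
    unfold R; field_simp [show (N : ℝ) - 1 ≠ 0 by linarith]
  have ha : 2 * N * ρ ≤ 2 / N := by
    rw [le_div_iff₀ (by positivity)]; nlinarith
  have hb : 2 * N * ρ ≤ 1 := by nlinarith
  have hRpos : 0 < R N ρ := by
    unfold R; apply div_pos <;> nlinarith
  have hlt : 1 < N * R N ρ := by
    have : (N : ℝ) * R N ρ * (N - 1) > 1 * (N - 1) := by nlinarith
    exact lt_of_mul_lt_mul_right this (by linarith)
  have h2R : 2 * ρ ≤ R N ρ := by
    have : N * (2 * ρ) ≤ N * R N ρ := by nlinarith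
    exact le_of_mul_le_mul_left this (by linarith)
  exact ⟨h2, ha, hb, hlt.le, hRpos, by linarith, h2R, hR, hlt, h1⟩

theorem pre_Ioo {N : ℕ} {ρ : ℝ} (hρ0 : 0 < ρ) (i : ℕ) (a b : ℝ) :
    f N ρ i ⁻¹' Ioo a b = Ioo ((a - i * R N ρ) / ρ) ((b - i * R N ρ) / ρ) := by
  ext x
  simp only [f, mem_preimage, mem_Ioo, div_lt_iff₀ hρ0, lt_div_iff₀ hρ0]
  constructor <;> rintro ⟨h1, h2⟩ <;> constructor <;> linarith

theorem pre_Iic {N : ℕ} {ρ : ℝ} (hρ0 : 0 < ρ) (i : ℕ) (a : ℝ) :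
    f N ρ i ⁻¹' Iic a = Iic ((a - i * R N ρ) / ρ) := by
  ext x
  simp only [f, mem_preimage, mem_Iic, le_div_iff₀ hρ0]
  constructor <;> intro h <;> linarith

theorem pre_Ici {N : ℕ} {ρ : ℝ} (hρ0 : 0 < ρ) (i : ℕ) (a : ℝ) :
    f N ρ i ⁻¹' Ici a = Ici ((a - i * R N ρ) / ρ) := by
  ext x
  simp only [f, mem_preimage, mem_Ici, div_le_iff₀ hρ0]
  constructor <;> intro h <;> linarith

theorem cdf_eq {N : ℕ} {ρ : ℝ} (hρ0 : 0 < ρ) {μ : Measure ℝ} [IsProbabilityMeasure μ]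
    (hss : IsSelfSimilar N ρ μ) (hN : 2 ≤ N) (t : ℝ) :
    (N : ℝ) * μ.real (Iic t) =
      ∑ i ∈ Finset.range N, μ.real (Iic ((t - i * R N ρ) / ρ)) := by
  rw [ss_real hss hN measurableSet_Iic]
  simp only [pre_Iic hρ0]

theorem ccdf_eq {N : ℕ} {ρ : ℝ} (hρ0 : 0 < ρ) (hρ1 : ρ ≤ 1 / (N : ℝ) ^ 2)
    {μ : Measure ℝ} [IsProbabilityMeasure μ]
    (hss : IsSelfSimilar N ρ μ) (hN : 2 ≤ N) (t : ℝ) :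
    (N : ℝ) * μ.real (Ici (1 - t)) =
      ∑ i ∈ Finset.range N, μ.real (Ici (1 - (t - i * R N ρ) / ρ)) := by
  obtain ⟨h2, -, -, -, -, -, -, hR, -⟩ := basic hN hρ0 hρ1
  rw [ss_real hss hN measurableSet_Ici, ← Finset.sum_range_reflect]
  refine Finset.sum_congr rfl fun i hi => ?_
  rw [pre_Ici hρ0]
  have hi' := Finset.mem_range.1 hi
  have : ((N - 1 - i : ℕ) : ℝ) = N - 1 - i := by
    rw [Nat.cast_sub (by omega), Nat.cast_sub (by omega)]; simp
  rw [this]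
  congr 2
  field_simp
  linarith

/-- A function of the type of a distribution function with value 0 at -∞, 
contracting below 0, vanishes below 0. -/
theorem Phi_zero {N : ℕ} {ρ : ℝ} (hN : 2 ≤ N) (hρ0 : 0 < ρ) (hρ1 : ρ ≤ 1 / (N : ℝ) ^ 2)
    (Φ : ℝ → ℝ) (hmono : Monotone Φ) (hbot : Tendsto Φ atBot (𝓝 0))
    (heq : ∀ t, (N : ℝ) * Φ t = ∑ i ∈ Finset.range N, Φ ((t - i * R N ρ) / ρ))
    (t : ℝ) (ht : t < 0) : Φ t ≤ 0 := by
  obtain ⟨h2, -, hb, -, hR, -⟩ := basic hN hρ0 hρ1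
  have step : ∀ t, Φ t ≤ Φ (t / ρ) := by
    intro t
    have : (N : ℝ) * Φ t ≤ N * Φ (t / ρ) := by
      rw [heq]
      calc _ ≤ ∑ i ∈ Finset.range N, Φ (t / ρ) := by
            refine Finset.sum_le_sum fun i _ => hmono ?_
            gcongr
            have : 0 ≤ (i : ℝ) * R N ρ := by positivity
            linarith
        _ = _ := by simp
    exact le_of_mul_le_mul_left this (by linarith)
  have hn : ∀ n : ℕ, Φ t ≤ Φ (t * (ρ⁻¹) ^ n) := by
    intro n
    induction n with
    | zero => simp
    | succ n ih =>
      refine ih.trans ((step _).trans (le_of_eq ?_))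
      congr 1
      rw [pow_succ, div_eq_mul_inv, mul_assoc]
  have hρ : 1 < ρ⁻¹ := (one_lt_inv₀ hρ0).2 (by nlinarith)
  have hlim : Tendsto (fun n : ℕ => t * (ρ⁻¹) ^ n) atTop atBot :=
    (tendsto_pow_atTop_atTop_of_one_lt hρ).const_mul_atTop_of_neg ht
  exact ge_of_tendsto' (hbot.comp hlim) hn

theorem supp_left {N : ℕ} {ρ : ℝ} (hN : 2 ≤ N) (hρ0 : 0 < ρ) (hρ1 : ρ ≤ 1 / (N : ℝ) ^ 2)
    {μ : Measure ℝ} [IsProbabilityMeasure μ] (hss : IsSelfSimilar N ρ μ) :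
    μ.real (Iio 0) = 0 := by
  have h : ∀ t < 0, μ (Iic t) = 0 := by
    intro t ht
    have h0 := Phi_zero hN hρ0 hρ1 (fun t => μ.real (Iic t))
      (fun a b hab => measureReal_mono (Iic_subset_Iic.2 hab))
      (by
        have := ProbabilityTheory.tendsto_cdf_atBot μ
        exact this.congr fun t => ProbabilityTheory.cdf_eq_real _ t)
      (cdf_eq hρ0 hss hN) t ht
    have h1 : μ.real (Iic t) = 0 := le_antisymm h0 measureReal_nonneg
    rwa [measureReal_eq_zero_iff] at h1
  rw [measureReal_eq_zero_iff]
  have : Iio (0 : ℝ) ⊆ ⋃ n : ℕ, Iic (-(1 / ((n : ℝ) + 1))) := by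
    intro x hx
    obtain ⟨n, hn⟩ := exists_nat_one_div_lt (show (0 : ℝ) < -x by simpa using hx)
    exact mem_iUnion.2 ⟨n, by simp only [mem_Iic]; linarith⟩
  refine measure_mono_null this (measure_iUnion_null fun n => h _ ?_)
  have : (0 : ℝ) < 1 / ((n : ℝ) + 1) := by positivity
  linarith

theorem supp_right {N : ℕ} {ρ : ℝ} (hN : 2 ≤ N) (hρ0 : 0 < ρ) (hρ1 : ρ ≤ 1 / (N : ℝ) ^ 2)
    {μ : Measure ℝ} [IsProbabilityMeasure μ] (hss : IsSelfSimilar N ρ μ) :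
    μ.real (Ioi 1) = 0 := by
  have h : ∀ t < 0, μ (Ici (1 - t)) = 0 := by
    intro t ht
    have h0 := Phi_zero hN hρ0 hρ1 (fun t => μ.real (Ici (1 - t)))
      (fun a b hab => measureReal_mono (Ici_subset_Ici.2 (by linarith)))
      (by
        have hA : AEMeasurable (fun x : ℝ => 1 - x) μ := by fun_prop
        have : IsProbabilityMeasure (μ.map (fun x : ℝ => 1 - x)) :=
          Measure.isProbabilityMeasure_map hA
        have := ProbabilityTheory.tendsto_cdf_atBot (μ.map (fun x : ℝ => 1 - x))
        refine this.congr fun t => ?_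
        rw [ProbabilityTheory.cdf_eq_real, map_measureReal_apply (by fun_prop) measurableSet_Iic]
        congr 1
        ext x
        simp only [mem_preimage, mem_Iic, mem_Ici]
        constructor <;> intro h <;> linarith)
      (ccdf_eq hρ0 hρ1 hss hN) t ht
    have h1 : μ.real (Ici (1 - t)) = 0 := le_antisymm h0 measureReal_nonneg
    rwa [measureReal_eq_zero_iff] at h1
  rw [measureReal_eq_zero_iff]
  have : Ioi (1 : ℝ) ⊆ ⋃ n : ℕ, Ici (1 - (-(1 / ((n : ℝ) + 1)))) := by
    intro x hx
    obtain ⟨n, hn⟩ := exists_nat_one_div_lt (show (0 : ℝ) < x - 1 by simpa using hx)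
    exact mem_iUnion.2 ⟨n, by simp only [mem_Ici]; linarith⟩
  refine measure_mono_null this (measure_iUnion_null fun n => h _ ?_)
  have : (0 : ℝ) < 1 / ((n : ℝ) + 1) := by positivity
  linarith

theorem Phi_lower {N : ℕ} {ρ : ℝ} (hN : 2 ≤ N) (hρ0 : 0 < ρ) (hρ1 : ρ ≤ 1 / (N : ℝ) ^ 2)
    (Φ : ℝ → ℝ) (h0 : ∀ t, 0 ≤ Φ t) (h1 : ∀ t, 1 ≤ t → Φ t = 1)
    (heq : ∀ t, (N : ℝ) * Φ t = ∑ i ∈ Finset.range N, Φ ((t - i * R N ρ) / ρ))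
    (t : ℝ) (ht0 : 0 ≤ t) (ht : t ≤ 1) : t / (N * R N ρ) ≤ Φ t := by
  obtain ⟨h2, -, hb, -, hR, hρR, -, hNR, hlt, -⟩ := basic hN hρ0 hρ1
  set Q := R N ρ with hQ
  have key : ∀ k : ℕ, ∀ t, 0 ≤ t → t ≤ 1 → t / (N * Q) ≤ Φ t + (1 / (N : ℝ)) ^ k := by
    intro k
    induction k with
    | zero =>
      intro t ht0 ht
      have : t / (N * Q) ≤ 1 := by
        rw [div_le_one (by positivity)]; linarith
      have := h0 t
      simp; linarith
    | succ k ih =>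
      intro t ht0 ht
      set i := ⌊t / Q⌋₊ with hi
      have hi1 : (i : ℝ) * Q ≤ t := by
        rw [← le_div_iff₀ hR]; exact Nat.floor_le (by positivity)
      have hi2 : t < (i + 1) * Q := by
        rw [← div_lt_iff₀ hR]; exact Nat.lt_floor_add_one _
      have hiN : i < N := by
        have : (i : ℝ) < N := by
          have : (i : ℝ) * Q < N * Q := by linarith
          exact lt_of_mul_lt_mul_right this hR.le
        exact_mod_cast this
      have hsum : (i : ℝ) + Φ ((t - i * Q) / ρ) ≤ N * Φ t := by
        rw [heq]
        calc (i : ℝ) + Φ ((t - i * Q) / ρ)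
            = ∑ l ∈ Finset.range (i + 1), Φ ((t - l * Q) / ρ) := by
              rw [Finset.sum_range_succ]
              congr 1
              rw [Finset.sum_congr rfl (g := fun _ => (1 : ℝ))]
              · simp
              · intro l hl
                apply h1
                rw [le_div_iff₀ hρ0]
                have : (l : ℝ) + 1 ≤ i := by exact_mod_cast Finset.mem_range.1 hl
                nlinarith
          _ ≤ _ := Finset.sum_le_sum_of_subset_of_nonneg
              (Finset.range_subset_range.2 hiN) (fun _ _ _ => h0 _)
      have hpow : (N : ℝ) * (1 / (N : ℝ)) ^ (k + 1) = (1 / (N : ℝ)) ^ k := by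
        rw [pow_succ]; field_simp
      have hpk : 0 ≤ (1 / (N : ℝ)) ^ k := by positivity
      have hterm : (t - i * Q) / Q ≤ Φ ((t - i * Q) / ρ) + (1 / (N : ℝ)) ^ k := by
        rcases le_or_gt 1 ((t - i * Q) / ρ) with hc | hc
        · rw [h1 _ hc]
          have : (t - i * Q) / Q ≤ 1 := by
            rw [div_le_one hR]; linarith
          linarith
        · refine le_trans ?_ (ih _ (div_nonneg (by linarith) hρ0.le) hc.le)
          rw [div_div]
          apply div_le_div_of_nonneg_left (by linarith) (by positivity)
          nlinarith
      have : (N : ℝ) * (t / (N * Q)) ≤ N * (Φ t + (1 / (N : ℝ)) ^ (k + 1)) := by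
        rw [mul_add, hpow]
        have e : (N : ℝ) * (t / (N * Q)) = i + (t - i * Q) / Q := by
          field_simp; ring
        rw [e]; linarith
      exact le_of_mul_le_mul_left this (by linarith)
  have hlim : Tendsto (fun k : ℕ => Φ t + (1 / (N : ℝ)) ^ k) atTop (𝓝 (Φ t + 0)) :=
    tendsto_const_nhds.add (tendsto_pow_atTop_nhds_zero_of_lt_one (by positivity)
      (by rw [div_lt_one] <;> linarith))
  rw [add_zero] at hlim
  exact ge_of_tendsto' hlim fun k => key k t ht0 ht

theorem F_lower {N : ℕ} {ρ : ℝ} (hN : 2 ≤ N) (hρ0 : 0 < ρ) (hρ1 : ρ ≤ 1 / (N : ℝ) ^ 2)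
    {μ : Measure ℝ} [IsProbabilityMeasure μ] (hss : IsSelfSimilar N ρ μ)
    (t : ℝ) (ht0 : 0 ≤ t) (ht : t ≤ 1) : t / (N * R N ρ) ≤ μ.real (Iic t) := by
  refine Phi_lower hN hρ0 hρ1 (fun t => μ.real (Iic t)) (fun t => measureReal_nonneg) ?_
    (cdf_eq hρ0 hss hN) t ht0 ht
  intro t ht
  have h := supp_right hN hρ0 hρ1 hss
  have h2 : μ.real (Ioi t) ≤ μ.real (Ioi 1) := measureReal_mono (Ioi_subset_Ioi ht)
  have h3 := probReal_add_probReal_compl (μ := μ) (measurableSet_Iic (a := t))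
  rw [compl_Iic] at h3
  have h4 : 0 ≤ μ.real (Ioi t) := measureReal_nonneg
  show μ.real (Iic t) = 1
  linarith

theorem G_lower {N : ℕ} {ρ : ℝ} (hN : 2 ≤ N) (hρ0 : 0 < ρ) (hρ1 : ρ ≤ 1 / (N : ℝ) ^ 2)
    {μ : Measure ℝ} [IsProbabilityMeasure μ] (hss : IsSelfSimilar N ρ μ)
    (t : ℝ) (ht0 : 0 ≤ t) (ht : t ≤ 1) : t / (N * R N ρ) ≤ μ.real (Ici (1 - t)) := by
  refine Phi_lower hN hρ0 hρ1 (fun t => μ.real (Ici (1 - t))) (fun t => measureReal_nonneg) ?_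
    (ccdf_eq hρ0 hρ1 hss hN) t ht0 ht
  intro t ht
  have h := supp_left hN hρ0 hρ1 hss
  have h2 : μ.real (Iio (1 - t)) ≤ μ.real (Iio 0) :=
    measureReal_mono (Iio_subset_Iio (by linarith))
  have h3 := probReal_add_probReal_compl (μ := μ) (measurableSet_Ici (a := 1 - t))
  rw [compl_Ici] at h3
  have h4 : 0 ≤ μ.real (Iio (1 - t)) := measureReal_nonneg
  show μ.real (Ici (1 - t)) = 1
  linarith

/-- The convexity inequality. -/
theorem convex_ineq {a z p : ℝ} (ha : 0 ≤ a) (hz : 0 ≤ z) (h : a + 2 * z ≤ 1) (hp : 2 ≤ p) :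
    (a + z) ^ p ≤ a + z ^ p := by
  rcases hz.eq_or_lt with rfl | hz
  · have : a ^ p ≤ a ^ (1 : ℝ) :=
      Real.rpow_le_rpow_of_exponent_ge' ha (by linarith) zero_le_one (by linarith)
    rw [Real.zero_rpow (by linarith)]
    simpa using this
  rcases ha.eq_or_lt with rfl | ha
  · simp
  obtain ⟨c, rfl⟩ : ∃ c, p = c + 1 := ⟨p - 1, by ring⟩
  have hc : 1 ≤ c := by linarith
  rw [Real.rpow_add_one (by positivity), Real.rpow_add_one (by positivity)]
  have hconv := convexOn_rpow hc
  have hs := hconv.secant_mono_aux2 (x := z) (y := a + z) (z := 1)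
    (by simpa using hz.le) (by simp) (by linarith) (by linarith)
  rw [Real.one_rpow, add_sub_cancel_right, div_le_div_iff₀ ha (by linarith)] at hs
  have hs4 : (1 - z) * (a + z) ^ c ≤ (1 - (a + z)) * z ^ c + a := by linarith
  have hzc : z ^ c ≤ 1 := Real.rpow_le_one hz.le (by linarith) (by linarith)
  have hz0 : 0 ≤ z ^ c := by positivity
  have : (1 - z) * ((a + z) ^ c * (a + z)) ≤ (1 - z) * (a + z ^ c * z) := by
    have h5 := mul_le_mul_of_nonneg_right hs4 (show 0 ≤ a + z by linarith)
    have h6 : 0 ≤ (1 - z ^ c) * (a * (1 - a - 2 * z)) :=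
      mul_nonneg (by linarith) (mul_nonneg ha.le (by linarith))
    nlinarith
  exact le_of_mul_le_mul_left this (by linarith)

theorem key_ineq {a z w s : ℝ} (ha : 0 ≤ a) (hz : 0 ≤ z) (h : a + 2 * z ≤ 1) (hs : 0 < s)
    (hs2 : s ≤ 1 / 2) (hw : 0 ≤ w) (hzw : z ≤ w ^ s) : a + z ≤ (a + w) ^ s := by
  have hp : 2 ≤ s⁻¹ := by
    rw [le_inv_comm₀ (by norm_num) hs]; linarith
  have h1 := convex_ineq ha hz h hp
  have h2 : z ^ s⁻¹ ≤ w := by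
    calc z ^ s⁻¹ ≤ (w ^ s) ^ s⁻¹ := Real.rpow_le_rpow hz hzw (by positivity)
      _ = w := Real.rpow_rpow_inv hw hs.ne'
  calc a + z = ((a + z) ^ s⁻¹) ^ s := (Real.rpow_inv_rpow (by positivity) hs.ne').symm
    _ ≤ (a + w) ^ s := Real.rpow_le_rpow (by positivity) (by linarith) hs.le

theorem E_facts {N : ℕ} {ρ : ℝ} (hN : 2 ≤ N) (hρ0 : 0 < ρ) (hρ1 : ρ ≤ 1 / (N : ℝ) ^ 2)
    {x : ℝ} (hx : x ∈ cantorE N ρ) :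
    0 ≤ x ∧ x ≤ 1 ∧ ∃ i : ℕ, i < N ∧ ∃ y ∈ cantorE N ρ, x = i * R N ρ + ρ * y := by
  obtain ⟨h2, -, hb, -, hR, hρR, -, hNR, hlt, -⟩ := basic hN hρ0 hρ1
  obtain ⟨d, hd, rfl⟩ := hx
  have hρlt : ρ < 1 := by nlinarith
  have hg : Summable fun i : ℕ => ((N : ℝ) - 1) * ρ ^ i :=
    (summable_geometric_of_lt_one hρ0.le hρlt).mul_left _
  have hle : ∀ i, (d i : ℝ) * ρ ^ i ≤ ((N : ℝ) - 1) * ρ ^ i := by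
    intro i
    have : (d i : ℝ) + 1 ≤ N := by exact_mod_cast hd i
    gcongr; linarith
  have hsum : Summable fun i : ℕ => (d i : ℝ) * ρ ^ i :=
    Summable.of_nonneg_of_le (fun i => by positivity) hle hg
  refine ⟨?_, ?_, d 0, hd 0, piMap N ρ (fun i => d (i + 1)), ⟨_, fun i => hd _, rfl⟩, ?_⟩
  · exact mul_nonneg hR.le (tsum_nonneg fun i => by positivity)
  · have := hsum.tsum_le_tsum hle hg
    rw [tsum_mul_left, tsum_geometric_of_lt_one hρ0.le hρlt] at this
    calc piMap N ρ d ≤ R N ρ * (((N : ℝ) - 1) * (1 - ρ)⁻¹) := by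
          unfold piMap; gcongr
      _ = 1 := by
          rw [← mul_assoc, mul_comm (R N ρ), hNR, mul_inv_cancel₀ (by linarith)]
  · unfold piMap
    rw [hsum.tsum_eq_zero_add]
    have : ∀ i : ℕ, (d (i + 1) : ℝ) * ρ ^ (i + 1) = ρ * ((d (i + 1) : ℝ) * ρ ^ i) := by
      intro i; ring
    simp only [this, tsum_mul_left]
    simp; ring

theorem g_zero {N : ℕ} {ρ : ℝ} (hN : 2 ≤ N) (hρ0 : 0 < ρ) (hρ1 : ρ ≤ 1 / (N : ℝ) ^ 2)
    {μ : Measure ℝ} [IsProbabilityMeasure μ] (hss : IsSelfSimilar N ρ μ)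
    {y r q : ℝ} (hy0 : 0 ≤ y) (hy1 : y ≤ 1) (hq : ρ ≤ q - r ∨ ρ ≤ -q - r) :
    μ.real (Ioo (y + (q - r) / ρ) (y + (q + r) / ρ)) = 0 := by
  refine le_antisymm ?_ measureReal_nonneg
  rcases hq with hq | hq
  · rw [← supp_right hN hρ0 hρ1 hss]
    refine measureReal_mono fun t ht => ?_
    have : 1 ≤ (q - r) / ρ := by rw [le_div_iff₀ hρ0]; linarith
    have := ht.1
    simp only [mem_Ioi]; linarith
  · rw [← supp_left hN hρ0 hρ1 hss]
    refine measureReal_mono fun t ht => ?_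
    have : (q + r) / ρ ≤ -1 := by rw [div_le_iff₀ hρ0]; linarith
    have := ht.2
    simp only [mem_Iio]; linarith

theorem g_pair {ρ : ℝ} {μ : Measure ℝ} [IsProbabilityMeasure μ] (y r q : ℝ) :
    μ.real (Ioo (y + (q - r) / ρ) (y + (q + r) / ρ)) +
      μ.real (Ioo (y + (-q - r) / ρ) (y + (-q + r) / ρ)) ≤
      1 + μ.real (Ioo (y - (r - q) / ρ) (y + (r - q) / ρ)) := by
  have e1 : y - (r - q) / ρ = y + (q - r) / ρ := by ring
  have e2 : y + (-q + r) / ρ = y + (r - q) / ρ := by ring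
  rw [e1, e2]
  rw [← measureReal_union_add_inter (s := Ioo (y + (q - r) / ρ) (y + (q + r) / ρ))
    measurableSet_Ioo]
  refine add_le_add measureReal_le_one (measureReal_mono fun t ht => ⟨ht.1.1, ht.2.2⟩)

theorem sum_Icc_bound (g : ℤ → ℝ) (g0 : ∀ n, 0 ≤ g n) (g1 : ∀ n, g n ≤ 1) (N i j : ℕ)
    (hj : 1 ≤ j) (hz : ∀ n : ℤ, (j : ℤ) + 1 ≤ |n| → g n = 0) :
    ∑ l ∈ Finset.range N, g ((i : ℤ) - l) ≤ 2 * j - 1 + (g j + g (-j)) := by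
  classical
  have h1 : ∑ l ∈ Finset.range N, g ((i : ℤ) - l) =
      ∑ n ∈ (Finset.range N).image (fun l : ℕ => (i : ℤ) - l), g n := by
    rw [Finset.sum_image]
    intro a _ b _ h
    simp only at h
    omega
  have h2 : ∑ n ∈ (Finset.range N).image (fun l : ℕ => (i : ℤ) - l), g n ≤
      ∑ n ∈ Finset.Icc (-(j : ℤ)) j, g n := by
    rw [← Finset.sum_filter_ne_zero]
    refine Finset.sum_le_sum_of_subset_of_nonneg (fun n hn' => ?_) fun n _ _ => g0 n
    have hn := (Finset.mem_filter.1 hn').2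
    by_contra hc
    apply hn (hz n _)
    rw [Finset.mem_Icc] at hc
    rcases abs_cases n with h | h <;> omega
  have h3 : Finset.Icc (-(j : ℤ)) j =
      insert (j : ℤ) (insert (-(j : ℤ)) (Finset.Icc (-(j : ℤ) + 1) ((j : ℤ) - 1))) := by
    ext n
    simp only [Finset.mem_insert, Finset.mem_Icc]
    omega
  rw [h1]
  refine h2.trans ?_
  rw [h3, Finset.sum_insert, Finset.sum_insert]
  · have h4 : ∑ n ∈ Finset.Icc (-(j : ℤ) + 1) ((j : ℤ) - 1), g n ≤ 2 * j - 1 := by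
      calc _ ≤ ∑ n ∈ Finset.Icc (-(j : ℤ) + 1) ((j : ℤ) - 1), (1 : ℝ) :=
            Finset.sum_le_sum fun n _ => g1 n
        _ = 2 * j - 1 := by
            rw [Finset.sum_const, Int.card_Icc, nsmul_eq_mul, mul_one]
            have : ((j : ℤ) - 1 + 1 - (-(j : ℤ) + 1)).toNat = 2 * j - 1 := by omega
            rw [this, Nat.cast_sub (by omega)]
            push_cast; ring
    linarith
  · simp
  · simp only [Finset.mem_insert, Finset.mem_Icc]
    omega

theorem s_facts {N : ℕ} {ρ s : ℝ} (hN : 2 ≤ N) (hρ0 : 0 < ρ) (hρ1 : ρ ≤ 1 / (N : ℝ) ^ 2)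
    (hs : s = -Real.log N / Real.log ρ) : 0 < s ∧ s ≤ 1 / 2 ∧ ρ ^ s = 1 / (N : ℝ) := by
  obtain ⟨h2, -, hb, -⟩ := basic hN hρ0 hρ1
  have hl : Real.log ρ < 0 := Real.log_neg hρ0 (by nlinarith)
  have hlN : 0 < Real.log N := Real.log_pos (by linarith)
  have h3 : Real.log ρ ≤ -(2 * Real.log N) := by
    have := Real.log_le_log hρ0 hρ1
    rwa [one_div, Real.log_inv, Real.log_pow, Nat.cast_ofNat] at this
  refine ⟨?_, ?_, ?_⟩
  · rw [hs]; exact div_pos_of_neg_of_neg (by linarith) hl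
  · rw [hs, div_le_iff_of_neg hl]; linarith
  · rw [Real.rpow_def_of_pos hρ0, hs, mul_div_cancel₀ _ hl.ne, Real.exp_neg,
      Real.exp_log (by linarith), one_div]

set_option maxHeartbeats 2000000 in
theorem main_bound {N : ℕ} {ρ s : ℝ} (hN : 2 ≤ N) (hρ0 : 0 < ρ) (hρ1 : ρ ≤ 1 / (N : ℝ) ^ 2)
    (hs : s = -Real.log N / Real.log ρ)
    {μ : Measure ℝ} [IsProbabilityMeasure μ] (hss : IsSelfSimilar N ρ μ)
    {m : ℕ} (hNm : N = 2 * m) (k : ℕ) :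
    ∀ x ∈ cantorE N ρ, ∀ r : ℝ, 0 < r →
      μ.real (Ioo (x - r) (x + r)) ≤ (2 * r / (N * R N ρ)) ^ s + (1 / (N : ℝ)) ^ k := by
  obtain ⟨h2, -, hb, -, hR, hρR, h2ρR, hNR, hlt, hρN⟩ := basic hN hρ0 hρ1
  obtain ⟨hs0, hs2, hρs⟩ := s_facts hN hρ0 hρ1 hs
  have hNm' : (N : ℝ) = 2 * m := by exact_mod_cast hNm
  have hN0 : (0 : ℝ) < N := by linarith
  induction k with
  | zero =>
    intro x _ r hr
    have h1 : μ.real (Ioo (x - r) (x + r)) ≤ 1 := measureReal_le_one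
    have h2 : 0 ≤ (2 * r / (N * R N ρ)) ^ s := by positivity
    simp; linarith
  | succ k ih =>
    intro x hx r hr
    obtain ⟨-, -, i, hi, y, hy, hxy⟩ := E_facts hN hρ0 hρ1 hx
    obtain ⟨hy0, hy1, -⟩ := E_facts hN hρ0 hρ1 hy
    set Q := R N ρ with hQ
    have hk0 : 0 ≤ (1 / (N : ℝ)) ^ (k + 1) := by positivity
    have hpow : (1 / (N : ℝ)) ^ (k + 1) = (1 / (N : ℝ)) ^ k / N := by
      rw [pow_succ]; field_simp
    rcases le_or_gt (m * Q) r with hbig | hsmall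
    · have h1 : μ.real (Ioo (x - r) (x + r)) ≤ 1 := measureReal_le_one
      have h3 : 1 ≤ (2 * r / (N * Q)) ^ s := by
        apply Real.one_le_rpow _ hs0.le
        rw [one_le_div (by positivity), hNm']
        nlinarith
      linarith
    set g : ℤ → ℝ := fun n => μ.real (Ioo (y + (n * Q - r) / ρ) (y + (n * Q + r) / ρ)) with hg
    have g0 : ∀ n, 0 ≤ g n := fun n => measureReal_nonneg
    have g1 : ∀ n, g n ≤ 1 := fun n => measureReal_le_one
    have hsum : (N : ℝ) * μ.real (Ioo (x - r) (x + r)) =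
        ∑ l ∈ Finset.range N, g ((i : ℤ) - l) := by
      rw [ss_real hss hN measurableSet_Ioo]
      refine Finset.sum_congr rfl fun l _ => ?_
      rw [pre_Ioo hρ0, hg, ← hQ, hxy]
      push_cast
      congr 2 <;> field_simp <;> ring
    -- choice of j
    obtain ⟨j, hj1, hj2⟩ : ∃ j : ℕ, j * Q - ρ < r ∧ r ≤ (j + 1) * Q - ρ := by
      have hpos : 0 < (r + ρ) / Q := by positivity
      have hc := Nat.ceil_pos.2 hpos
      refine ⟨⌈(r + ρ) / Q⌉₊ - 1, ?_, ?_⟩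
      · have : (⌈(r + ρ) / Q⌉₊ - 1 : ℕ) < (r + ρ) / Q := by
          rw [← Nat.lt_ceil]; omega
        rw [lt_div_iff₀ hR] at this
        linarith
      · have : (r + ρ) / Q ≤ ⌈(r + ρ) / Q⌉₊ := Nat.le_ceil _
        rw [div_le_iff₀ hR] at this
        rw [Nat.cast_sub (by omega)]
        push_cast; linarith
    have hz : ∀ n : ℤ, (j : ℤ) + 1 ≤ |n| → g n = 0 := by
      intro n hn
      have hn' : (j : ℝ) + 1 ≤ |(n : ℝ)| := by exact_mod_cast hn
      apply g_zero hN hρ0 hρ1 hss hy0 hy1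
      rcases abs_cases (n : ℝ) with h | h
      · left; rw [h.1] at hn'; nlinarith
      · right; rw [h.1] at hn'; nlinarith
    have hjm : j ≤ m := by
      have : (j : ℝ) < m + 1 := by
        have : (j : ℝ) * Q < (m + 1) * Q := by nlinarith
        exact lt_of_mul_lt_mul_right this hR.le
      have : j < m + 1 := by exact_mod_cast this
      omega
    -- scaling of the comparison function
    have hscale : ∀ v : ℝ, 0 ≤ v →
        (2 * (v / ρ) / (N * Q)) ^ s = N * (2 * v / (N * Q)) ^ s := by
      intro v hv
      have e : 2 * v / (N * Q) = ρ * (2 * (v / ρ) / (N * Q)) := by field_simp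
      rw [e, Real.mul_rpow hρ0.le (by positivity), hρs]
      field_simp
    suffices h : (N : ℝ) * μ.real (Ioo (x - r) (x + r)) ≤
        N * ((2 * r / (N * Q)) ^ s + (1 / (N : ℝ)) ^ (k + 1)) from
      le_of_mul_le_mul_left h hN0
    have hNk : (N : ℝ) * (1 / (N : ℝ)) ^ (k + 1) = (1 / (N : ℝ)) ^ k := by
      rw [hpow]; field_simp
    have hk : 0 ≤ (1 / (N : ℝ)) ^ k := by positivity
    rw [mul_add, hNk]
    rcases Nat.eq_zero_or_pos j with rfl | hjpos
    · -- only one piece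
      have : ∑ l ∈ Finset.range N, g ((i : ℤ) - l) = g 0 := by
        rw [Finset.sum_eq_single i]
        · simp
        · intro l _ hl
          apply hz
          have : (i : ℤ) - l ≠ 0 := by omega
          have := Int.one_le_abs this
          simpa using this
        · intro h; exact absurd (Finset.mem_range.2 hi) h
      rw [hsum, this, ← hscale r hr.le]
      have := ih y hy (r / ρ) (by positivity)
      refine le_trans (le_of_eq ?_) this
      simp only [hg]
      congr 2 <;> push_cast <;> ring
    have hj1' : (1 : ℝ) ≤ j := by exact_mod_cast hjpos
    rcases hjm.eq_or_lt with rfl | hjlt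
    · -- top case
      set v := j * Q - r with hv
      have hv0 : 0 < v := by linarith
      have hvρ : v < ρ := by linarith
      have hvt0 : 0 ≤ v / ρ := by positivity
      have hvt1 : v / ρ ≤ 1 := by rw [div_le_one hρ0]; exact hvρ.le
      have hone : ∃ l₀ ∈ Finset.range N, g ((i : ℤ) - l₀) ≤ 1 - v / ρ / (N * Q) := by
        rcases le_or_gt j i with hij | hij
        · refine ⟨i - j, Finset.mem_range.2 (by omega), ?_⟩
          have e : (i : ℤ) - ((i - j : ℕ) : ℤ) = j := by omega
          rw [e]
          have hF := F_lower hN hρ0 hρ1 hss (v / ρ) hvt0 hvt1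
          have h3 := probReal_add_probReal_compl (μ := μ) (measurableSet_Iic (a := v / ρ))
          have h4 : g j ≤ μ.real (Iic (v / ρ))ᶜ := by
            refine measureReal_mono fun t ht => ?_
            have h5 := ht.1
            simp only [mem_compl_iff, mem_Iic, not_le]
            push_cast at h5
            rw [← hv] at h5
            linarith
          linarith
        · refine ⟨i + j, Finset.mem_range.2 (by omega), ?_⟩
          have e : (i : ℤ) - ((i + j : ℕ) : ℤ) = -j := by omega
          rw [e]
          have hF := G_lower hN hρ0 hρ1 hss (v / ρ) hvt0 hvt1
          have h3 := probReal_add_probReal_compl (μ := μ) (measurableSet_Ici (a := 1 - v / ρ))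
          have h4 : g (-j) ≤ μ.real (Ici (1 - v / ρ))ᶜ := by
            refine measureReal_mono fun t ht => ?_
            have h5 := ht.2
            simp only [mem_compl_iff, mem_Ici, not_le]
            push_cast at h5
            rw [show -(j : ℝ) * Q + r = -v by rw [hv]; ring, neg_div] at h5
            linarith
          linarith
      obtain ⟨l₀, hl₀, hgl⟩ := hone
      have hS : ∑ l ∈ Finset.range N, g ((i : ℤ) - l) ≤ N - v / ρ / (N * Q) := by
        rw [← Finset.add_sum_erase _ _ hl₀]
        have : ∑ l ∈ (Finset.range N).erase l₀, g ((i : ℤ) - l) ≤ N - 1 := by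
          calc _ ≤ ∑ l ∈ (Finset.range N).erase l₀, (1 : ℝ) :=
                Finset.sum_le_sum fun l _ => g1 _
            _ = N - 1 := by
                rw [Finset.sum_const, Finset.card_erase_of_mem hl₀, Finset.card_range,
                  nsmul_eq_mul, mul_one, Nat.cast_sub (by omega)]
                simp
        linarith
      have hw : 2 * r / (N * Q) = 1 - 2 * v / (N * Q) := by
        rw [eq_sub_iff_add_eq, ← add_div, div_eq_one_iff_eq (by positivity), hNm', hv]; ring
      have hw1 : 2 * r / (N * Q) ≤ 1 := by
        rw [hw]
        have : 0 ≤ 2 * v / (N * Q) := by positivity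
        linarith
      have hw2 : 2 * r / (N * Q) ≤ (2 * r / (N * Q)) ^ s := by
        have := Real.rpow_le_rpow_of_exponent_ge' (x := 2 * r / (N * Q)) (by positivity) hw1
          hs0.le (show s ≤ 1 by linarith)
        rwa [Real.rpow_one] at this
      have hw3 : N * (2 * v / (N * Q)) ≤ v / ρ / (N * Q) := by
        rw [mul_div_assoc', div_le_div_iff_of_pos_right (by positivity), le_div_iff₀ hρ0]
        have := mul_le_mul_of_nonneg_right hb hv0.le
        linarith
      have hw4 : (N : ℝ) * (2 * r / (N * Q)) ≤ N * (2 * r / (N * Q)) ^ s :=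
        mul_le_mul_of_nonneg_left hw2 hN0.le
      rw [hsum]
      rw [hw, mul_sub] at hw4
      rw [hw]
      linarith
    · -- middle case
      have hjm1 : (j : ℝ) + 1 ≤ m := by exact_mod_cast hjlt
      have hS := sum_Icc_bound g g0 g1 N i j hjpos hz
      have hP := g_pair (ρ := ρ) (μ := μ) y r (j * Q)
      have hP' : g j + g (-j) ≤
          1 + μ.real (Ioo (y - (r - j * Q) / ρ) (y + (r - j * Q) / ρ)) := by
        refine le_trans (le_of_eq ?_) hP
        simp only [hg]
        push_cast
        simp only [neg_mul]
      set u := r - j * Q with hu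
      set a : ℝ := 2 * j / N with ha
      have ha0 : 0 ≤ a := by positivity
      have haN : a * N = 2 * j := by rw [ha]; field_simp
      have hru : 2 * r / (N * Q) = a + 2 * u / (N * Q) := by
        rw [ha, hu]; field_simp; ring
      rw [hsum]
      rcases le_or_gt u 0 with hu0 | hu0
      · have he : μ.real (Ioo (y - u / ρ) (y + u / ρ)) = 0 := by
          rw [Ioo_eq_empty]
          · simp
          · have : u / ρ ≤ 0 := div_nonpos_of_nonpos_of_nonneg hu0 hρ0.le
            linarith
        have ha1 : a ≤ 1 := by
          rw [ha, div_le_one hN0]; linarith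
        have hsq : a ^ 2 ≤ 2 * r / (N * Q) := by
          rw [ha, div_pow, div_le_div_iff₀ (by positivity) (by positivity)]
          have h5 : 2 * r ≥ 2 * j * Q - 2 * ρ := by linarith
          have h6 : (2 * (j : ℝ)) ^ 2 * Q + 2 * ρ * N ≤ 2 * j * N * Q := by
            have h7 : 2 * ρ * N ≤ 1 := by linarith
            have h8 : 1 ≤ 2 * j * (N - 2 * j) * Q := by
              have : (N : ℝ) ≤ 2 * j * (N - 2 * j) := by nlinarith
              nlinarith
            nlinarith
          nlinarith
        have h9 : a ≤ (2 * r / (N * Q)) ^ s := by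
          calc a = (a ^ 2) ^ (1 / 2 : ℝ) := by
                rw [← Real.sqrt_eq_rpow, Real.sqrt_sq ha0]
            _ ≤ (a ^ 2) ^ s :=
                Real.rpow_le_rpow_of_exponent_ge' (by positivity) (by nlinarith) hs0.le hs2
            _ ≤ _ := Real.rpow_le_rpow (by positivity) hsq hs0.le
        have h10 := mul_le_mul_of_nonneg_left h9 hN0.le
        linarith
      · set w := 2 * u / (N * Q) with hw
        have hw0 : 0 ≤ w := by positivity
        set z := min (1 / (N : ℝ)) (w ^ s) with hzdef
        have hz0 : 0 ≤ z := le_min (by positivity) (by positivity)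
        have hzN : z * N ≤ 1 := by
          have : z ≤ 1 / N := min_le_left _ _
          rwa [le_div_iff₀ hN0] at this
        have haz : a + 2 * z ≤ 1 := by
          have : (a + 2 * z) * N ≤ 1 * N := by linarith
          exact le_of_mul_le_mul_right this hN0
        have hkey := key_ineq ha0 hz0 haz hs0 hs2 hw0 (min_le_right _ _)
        rw [← hru] at hkey
        have hI := ih y hy (u / ρ) (by positivity)
        rw [hscale u hu0.le, ← hw] at hI
        have hball : μ.real (Ioo (y - u / ρ) (y + u / ρ)) ≤ N * z + (1 / (N : ℝ)) ^ k := by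
          rcases min_choice (1 / (N : ℝ)) (w ^ s) with h | h
          · rw [hzdef, h]
            have : μ.real (Ioo (y - u / ρ) (y + u / ρ)) ≤ 1 := measureReal_le_one
            have e : (N : ℝ) * (1 / N) = 1 := by field_simp
            linarith
          · rw [hzdef, h]; exact hI
        have h10 := mul_le_mul_of_nonneg_left hkey hN0.le
        linarith

/-- Lemma 2.8: if `N` is even then `Θ^{*s}(μ,x) ≤ (NR)^{-s}` for every `x ∈ E`. -/
theorem upperDensity_le_of_even (N : ℕ) (hN : 2 ≤ N) (ρ : ℝ) (hρ0 : 0 < ρ)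
    (hρ1 : ρ ≤ 1 / (N : ℝ) ^ 2) (s : ℝ) (hs : s = -Real.log N / Real.log ρ)
    (μ : Measure ℝ) (hprob : IsProbabilityMeasure μ) (hss : IsSelfSimilar N ρ μ)
    (m : ℕ) (hm : 1 ≤ m) (hNm : N = 2 * m) :
    ∀ x ∈ cantorE N ρ, upperDensity μ s x ≤ ((N : ℝ) * R N ρ) ^ (-s) := by
  intro x hx
  obtain ⟨h2, -, hb, -, hR, -⟩ := basic hN hρ0 hρ1
  obtain ⟨hs0, hs2, hρs⟩ := s_facts hN hρ0 hρ1 hs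
  have hN0 : (0 : ℝ) < N := by linarith
  have key : ∀ r : ℝ, 0 < r →
      (μ (Ioo (x - r) (x + r))).toReal / (2 * r) ^ s ≤ ((N : ℝ) * R N ρ) ^ (-s) := by
    intro r hr
    have hlim : Tendsto (fun k : ℕ => (2 * r / (N * R N ρ)) ^ s + (1 / (N : ℝ)) ^ k) atTop
        (𝓝 ((2 * r / (N * R N ρ)) ^ s + 0)) :=
      tendsto_const_nhds.add (tendsto_pow_atTop_nhds_zero_of_lt_one (by positivity)
        (by rw [div_lt_one] <;> linarith))
    rw [add_zero] at hlim
    have h := ge_of_tendsto' hlim fun k => main_bound hN hρ0 hρ1 hs hss hNm k x hx r hr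
    rw [div_le_iff₀ (by positivity)]
    refine h.trans (le_of_eq ?_)
    rw [Real.div_rpow (by positivity) (by positivity), Real.rpow_neg (by positivity)]
    ring
  unfold upperDensity
  refine limsup_le_of_le ?_ ?_
  · refine IsCoboundedUnder.of_frequently_ge (a := 0) (Eventually.frequently ?_)
    filter_upwards [self_mem_nhdsWithin] with r hr
    have : (0 : ℝ) < r := hr
    positivity
  · filter_upwards [self_mem_nhdsWithin] with r hr
    exact key r hr

end HomogeneousCantorDensity
end

section
/- For any t ∈ [0,1] \ E one has dim_H E_γ(t) = dim_H π(E'_γ(t)). -/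
open MeasureTheory Filter Set Topology ENNReal

namespace HomogeneousCantorDensity

/-- reflection of a sequence: `(c_i) ↦ (N-1-c_i)`. -/
def reflSeq (N : ℕ) (a : ℕ → ℕ) : ℕ → ℕ := fun i => N - 1 - a i

/-- lexicographic order `a ≼ b` on sequences. -/
def lexLE (a b : ℕ → ℕ) : Prop :=
  a = b ∨ ∃ n : ℕ, (∀ i < n, a i = b i) ∧ a n < b n

/-- the shifted sequence `d_{n+1} d_{n+2} …` (0-indexed). -/
def shiftSeq (d : ℕ → ℕ) (n : ℕ) : ℕ → ℕ := fun i => d (n + i)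

/-- `γ_{n+1}(x)` for `x = piMap N ρ d` (`d` 0-indexed, so `d n` is the digit `d_{n+1}`). -/
noncomputable def gam (N : ℕ) (ρ : ℝ) (d : ℕ → ℕ) (n : ℕ) : ℝ :=
  if d n = 0 then Tn N ρ d (n + 1)
  else if d n = N - 1 then 1 - Tn N ρ d (n + 1)
  else max (Tn N ρ d (n + 1)) (1 - Tn N ρ d (n + 1))

/-- `E_γ(t) = {x ∈ E : liminf_n γ_n(x) ≥ t}`. -/
def Egamma (N : ℕ) (ρ : ℝ) (t : ℝ) : Set ℝ :=
  {x | ∃ d : ℕ → ℕ, (∀ i, d i < N) ∧ x = piMap N ρ d ∧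
    t ≤ liminf (fun n => gam N ρ d n) atTop}

/-- the symbolic set `E'_γ(t)`, described via the coding `α` of the smallest element of `E`
that is `≥ t`. -/
def Egamma' (N : ℕ) (α : ℕ → ℕ) : Set (ℕ → ℕ) :=
  {d | (∀ i, d i < N) ∧ ∀ n : ℕ,
    (d n = 0 → lexLE α (shiftSeq d (n + 1))) ∧
    (1 ≤ d n → d n ≤ N - 2 →
      lexLE α (shiftSeq d (n + 1)) ∨ lexLE (shiftSeq d (n + 1)) (reflSeq N α)) ∧
    (d n = N - 1 → lexLE (shiftSeq d (n + 1)) (reflSeq N α))}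


lemma N_rho_lt {N : ℕ} (hN : 2 ≤ N) {ρ : ℝ} (hρ1 : ρ ≤ 1 / (N : ℝ) ^ 2) :
    (N : ℝ) * ρ < 1 := by
  have h2 : (2 : ℝ) ≤ N := by exact_mod_cast hN
  rw [le_div_iff₀ (by positivity)] at hρ1
  nlinarith

lemma rho_lt_one {N : ℕ} (hN : 2 ≤ N) {ρ : ℝ} (hρ0 : 0 < ρ) (h : (N : ℝ) * ρ < 1) : ρ < 1 := by
  have h2 : (2 : ℝ) ≤ N := by exact_mod_cast hN
  nlinarith

lemma rho_lt_R {N : ℕ} (hN : 2 ≤ N) {ρ : ℝ} (h : (N : ℝ) * ρ < 1) : ρ < R N ρ := by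
  have h2 : (2 : ℝ) ≤ N := by exact_mod_cast hN
  unfold R
  rw [lt_div_iff₀ (by linarith)]
  nlinarith

lemma summ {N : ℕ} {ρ : ℝ} (hρ0 : 0 < ρ) (hρ : ρ < 1) (d : ℕ → ℕ) (hd : ∀ i, d i < N) :
    Summable (fun i => (d i : ℝ) * ρ ^ i) := by
  refine Summable.of_nonneg_of_le (fun i => by positivity) (fun i => ?_)
    ((summable_geometric_of_lt_one hρ0.le hρ).mul_left (N : ℝ))
  have : (d i : ℝ) ≤ N := by exact_mod_cast (hd i).le
  gcongr

lemma piMap_refl {N : ℕ} (hN : 2 ≤ N) {ρ : ℝ} (hρ0 : 0 < ρ) (hρ : ρ < 1) (d : ℕ → ℕ)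
    (hd : ∀ i, d i < N) : piMap N ρ (reflSeq N d) = 1 - piMap N ρ d := by
  have h2 : (2 : ℝ) ≤ N := by exact_mod_cast hN
  have e : ∀ i, ((reflSeq N d i : ℕ) : ℝ) * ρ ^ i = ((N : ℝ) - 1) * ρ ^ i - (d i : ℝ) * ρ ^ i := by
    intro i
    have : ((reflSeq N d i : ℕ) : ℝ) + d i = N - 1 := by
      have h : reflSeq N d i + d i + 1 = N := by
        have := hd i
        unfold reflSeq
        omega
      have h' : ((reflSeq N d i : ℕ) : ℝ) + d i + 1 = N := by exact_mod_cast h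
      linarith
    rw [← this]; ring
  unfold piMap
  simp_rw [e]
  rw [Summable.tsum_sub ((summable_geometric_of_lt_one hρ0.le hρ).mul_left _) (summ hρ0 hρ d hd),
    tsum_mul_left, tsum_geometric_of_lt_one hρ0.le hρ]
  unfold R
  have : (N : ℝ) - 1 ≠ 0 := by linarith
  have : 1 - ρ ≠ 0 := by linarith
  field_simp

lemma R_pos {N : ℕ} (hN : 2 ≤ N) {ρ : ℝ} (hρ : ρ < 1) : 0 < R N ρ := by
  have h2 : (2 : ℝ) ≤ N := by exact_mod_cast hN
  exact div_pos (by linarith) (by linarith)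

lemma piMap_nonneg {N : ℕ} (hN : 2 ≤ N) {ρ : ℝ} (hρ0 : 0 < ρ) (hρ : ρ < 1) (d : ℕ → ℕ) :
    0 ≤ piMap N ρ d :=
  mul_nonneg (R_pos hN hρ).le (tsum_nonneg (fun i => by positivity))

lemma refl_lt {N : ℕ} (hN : 2 ≤ N) (d : ℕ → ℕ) (i : ℕ) : reflSeq N d i < N := by
  unfold reflSeq; omega

lemma piMap_le_one {N : ℕ} (hN : 2 ≤ N) {ρ : ℝ} (hρ0 : 0 < ρ) (hρ : ρ < 1) (d : ℕ → ℕ)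
    (hd : ∀ i, d i < N) : piMap N ρ d ≤ 1 := by
  have := piMap_nonneg hN hρ0 hρ (reflSeq N d)
  rw [piMap_refl hN hρ0 hρ d hd] at this
  linarith

lemma piMap_split {N : ℕ} {ρ : ℝ} (hρ0 : 0 < ρ) (hρ : ρ < 1) (d : ℕ → ℕ)
    (hd : ∀ i, d i < N) (k : ℕ) :
    piMap N ρ d = R N ρ * ∑ i ∈ Finset.range k, (d i : ℝ) * ρ ^ i
      + ρ ^ k * piMap N ρ (shiftSeq d k) := by
  unfold piMap shiftSeq
  rw [← (summ hρ0 hρ d hd).sum_add_tsum_nat_add k]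
  have : ∀ i, (d (i + k) : ℝ) * ρ ^ (i + k) = ρ ^ k * ((d (k + i) : ℝ) * ρ ^ i) := by
    intro i; rw [add_comm i k, pow_add]; ring
  simp_rw [this]
  rw [tsum_mul_left]
  ring

lemma piMap_lt {N : ℕ} (hN : 2 ≤ N) {ρ : ℝ} (hρ0 : 0 < ρ) (h : (N : ℝ) * ρ < 1)
    (a b : ℕ → ℕ) (ha : ∀ i, a i < N) (hb : ∀ i, b i < N) (n : ℕ)
    (hn : ∀ i < n, a i = b i) (hlt : a n < b n) : piMap N ρ a < piMap N ρ b := by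
  have hρ := rho_lt_one hN hρ0 h
  have hR := rho_lt_R hN h
  rw [piMap_split hρ0 hρ a ha (n + 1), piMap_split hρ0 hρ b hb (n + 1),
    Finset.sum_range_succ, Finset.sum_range_succ]
  have e : ∑ i ∈ Finset.range n, (a i : ℝ) * ρ ^ i = ∑ i ∈ Finset.range n, (b i : ℝ) * ρ ^ i :=
    Finset.sum_congr rfl (fun i hi => by rw [hn i (Finset.mem_range.1 hi)])
  rw [e]
  have h1 := piMap_le_one hN hρ0 hρ (shiftSeq a (n+1)) (fun i => ha _)
  have h0 := piMap_nonneg hN hρ0 hρ (shiftSeq b (n+1))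
  have hab : (a n : ℝ) + 1 ≤ b n := by exact_mod_cast hlt
  have hp : 0 < ρ ^ n := by positivity
  have key : R N ρ * a n + ρ * piMap N ρ (shiftSeq a (n+1))
      < R N ρ * b n + ρ * piMap N ρ (shiftSeq b (n+1)) := by
    have hRp := R_pos hN hρ
    have t1 : R N ρ * (a n + 1) ≤ R N ρ * b n := by gcongr
    have t2 := mul_le_mul_of_nonneg_left h1 hρ0.le
    have t3 := mul_nonneg hρ0.le h0
    linarith
  have := mul_lt_mul_of_pos_left key hp
  rw [pow_succ]
  linarith

lemma lexLE_iff {N : ℕ} (hN : 2 ≤ N) {ρ : ℝ} (hρ0 : 0 < ρ) (h : (N : ℝ) * ρ < 1)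
    (a b : ℕ → ℕ) (ha : ∀ i, a i < N) (hb : ∀ i, b i < N) :
    lexLE a b ↔ piMap N ρ a ≤ piMap N ρ b := by
  constructor
  · rintro (rfl | ⟨n, hn, hlt⟩)
    · exact le_rfl
    · exact (piMap_lt hN hρ0 h a b ha hb n hn hlt).le
  · intro hle
    by_cases hab : a = b
    · exact Or.inl hab
    · have hex : ∃ n, a n ≠ b n := by
        by_contra hcon
        push Not at hcon
        exact hab (funext hcon)
      classical
      have hs := Nat.find_spec hex
      have hm : ∀ i < Nat.find hex, a i = b i := fun i hi => by
        have := Nat.find_min hex hi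
        simpa using this
      rcases lt_or_gt_of_ne hs with hl | hl
      · exact Or.inr ⟨_, hm, hl⟩
      · have := piMap_lt hN hρ0 h b a hb ha _ (fun i hi => (hm i hi).symm) hl
        linarith

lemma isClosed_cantorE (N : ℕ) {ρ : ℝ} (hρ0 : 0 < ρ) (hρ : ρ < 1) :
    IsClosed (cantorE N ρ) := by
  have hc : Continuous (fun d : ℕ → Fin N => piMap N ρ (fun i => (d i : ℕ))) := by
    unfold piMap
    refine continuous_const.mul ?_
    refine continuous_tsum (u := fun i => (N : ℝ) * ρ ^ i) (fun i => ?_)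
      ((summable_geometric_of_lt_one hρ0.le hρ).mul_left (N : ℝ)) (fun i d => ?_)
    · refine Continuous.mul ?_ continuous_const
      exact (continuous_of_discreteTopology (f := fun x : Fin N => ((x : ℕ) : ℝ))).comp
        (continuous_apply i)
    · rw [Real.norm_of_nonneg (by positivity)]
      have : ((d i : ℕ) : ℝ) ≤ N := by exact_mod_cast (d i).2.le
      gcongr
  have : cantorE N ρ = range (fun d : ℕ → Fin N => piMap N ρ (fun i => (d i : ℕ))) := by
    ext x
    constructor
    · rintro ⟨d, hd, rfl⟩
      exact ⟨fun i => ⟨d i, hd i⟩, rfl⟩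
    · rintro ⟨d, rfl⟩
      exact ⟨fun i => d i, fun i => (d i).2, rfl⟩
  rw [this]
  exact (isCompact_range hc).isClosed

lemma gam_mem {N : ℕ} (hN : 2 ≤ N) {ρ : ℝ} (hρ0 : 0 < ρ) (hρ : ρ < 1) (d : ℕ → ℕ)
    (hd : ∀ i, d i < N) (n : ℕ) : gam N ρ d n ∈ cantorE N ρ := by
  have h1 : Tn N ρ d (n + 1) ∈ cantorE N ρ := ⟨_, fun i => hd _, rfl⟩
  have h2 : 1 - Tn N ρ d (n + 1) ∈ cantorE N ρ :=
    ⟨reflSeq N (fun i => d (n + 1 + i)), refl_lt hN _,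
      (piMap_refl hN hρ0 hρ _ (fun i => hd _)).symm⟩
  unfold gam
  split_ifs
  · exact h1
  · exact h2
  · rcases max_choice (Tn N ρ d (n + 1)) (1 - Tn N ρ d (n + 1)) with e | e <;> rw [e] <;> assumption

lemma cond_iff {N : ℕ} (hN : 2 ≤ N) {ρ : ℝ} (hρ0 : 0 < ρ) (h : (N : ℝ) * ρ < 1)
    (α d : ℕ → ℕ) (hα : ∀ i, α i < N) (hd : ∀ i, d i < N) (n : ℕ) :
    ((d n = 0 → lexLE α (shiftSeq d (n + 1))) ∧
    (1 ≤ d n → d n ≤ N - 2 →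
      lexLE α (shiftSeq d (n + 1)) ∨ lexLE (shiftSeq d (n + 1)) (reflSeq N α)) ∧
    (d n = N - 1 → lexLE (shiftSeq d (n + 1)) (reflSeq N α))) ↔ piMap N ρ α ≤ gam N ρ d n := by
  have hρ := rho_lt_one hN hρ0 h
  have hs : ∀ i, shiftSeq d (n + 1) i < N := fun i => hd _
  rw [lexLE_iff hN hρ0 h _ _ hα hs, lexLE_iff hN hρ0 h _ _ hs (refl_lt hN α),
    piMap_refl hN hρ0 hρ α hα]
  have e : Tn N ρ d (n + 1) = piMap N ρ (shiftSeq d (n + 1)) := rfl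
  have e2 : piMap N ρ (shiftSeq d (n + 1)) ≤ 1 - piMap N ρ α ↔
      piMap N ρ α ≤ 1 - piMap N ρ (shiftSeq d (n + 1)) := by
    constructor <;> intro <;> linarith
  rw [e2]
  unfold gam
  rw [e]
  have := hd n
  split_ifs with c1 c2
  · constructor
    · intro H; exact H.1 c1
    · intro H; exact ⟨fun _ => H, fun _ => by omega, fun _ => by omega⟩
  · constructor
    · intro H; exact H.2.2 c2
    · intro H; exact ⟨fun _ => by omega, fun _ _ => by omega, fun _ => H⟩
  · rw [le_max_iff]
    constructor
    · intro H; exact H.2.1 (by omega) (by omega)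
    · intro H; exact ⟨fun _ => by omega, fun _ _ => H, fun _ => by omega⟩

lemma gam_shift (N : ℕ) (ρ : ℝ) (d : ℕ → ℕ) (k n : ℕ) :
    gam N ρ (shiftSeq d k) n = gam N ρ d (k + n) := by
  simp only [gam, Tn, shiftSeq, add_assoc]

lemma liminf_iff {N : ℕ} (hN : 2 ≤ N) {ρ : ℝ} (hρ0 : 0 < ρ) (h : (N : ℝ) * ρ < 1)
    {t : ℝ} (htE : t ∉ cantorE N ρ) (α d : ℕ → ℕ) (hd : ∀ i, d i < N)
    (hα1 : t ≤ piMap N ρ α)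
    (hα2 : ∀ y ∈ cantorE N ρ, t ≤ y → piMap N ρ α ≤ y) :
    t ≤ liminf (fun n => gam N ρ d n) atTop ↔ ∀ᶠ n in atTop, piMap N ρ α ≤ gam N ρ d n := by
  have hρ := rho_lt_one hN hρ0 h
  have hm := gam_mem hN hρ0 hρ d hd
  have h01 : ∀ n, 0 ≤ gam N ρ d n ∧ gam N ρ d n ≤ 1 := fun n => by
    obtain ⟨e, he, heq⟩ := hm n
    rw [heq]
    exact ⟨piMap_nonneg hN hρ0 hρ e, piMap_le_one hN hρ0 hρ e he⟩
  have hb : IsBoundedUnder (· ≥ ·) atTop (fun n => gam N ρ d n) :=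
    isBoundedUnder_of ⟨0, fun n => (h01 n).1⟩
  have hb' : IsBoundedUnder (· ≤ ·) atTop (fun n => gam N ρ d n) :=
    isBoundedUnder_of ⟨1, fun n => (h01 n).2⟩
  constructor
  · intro hl
    have hopen := (isClosed_cantorE N hρ0 hρ).isOpen_compl
    obtain ⟨ε, hε, hball⟩ := Metric.isOpen_iff.1 hopen t htE
    have hlt : t - ε < liminf (fun n => gam N ρ d n) atTop := by linarith
    filter_upwards [eventually_lt_of_lt_liminf hlt hb] with n hn
    apply hα2 _ (hm n)
    by_contra hcon
    push Not at hcon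
    refine hball ?_ (hm n)
    rw [Metric.mem_ball, Real.dist_eq, abs_lt]
    constructor <;> linarith
  · intro he
    exact le_liminf_of_le hb'.isCoboundedUnder_ge (he.mono fun n hn => hα1.trans hn)

/-- Proposition 3.2: `dim_H E_γ(t) = dim_H π(E'_γ(t))` for `t ∈ [0,1] \ E`. -/
theorem dimH_Egamma_eq (N : ℕ) (hN : 2 ≤ N) (ρ : ℝ) (hρ0 : 0 < ρ)
    (hρ1 : ρ ≤ 1 / (N : ℝ) ^ 2)
    (t : ℝ) (ht : t ∈ Icc (0 : ℝ) 1) (htE : t ∉ cantorE N ρ)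
    (α : ℕ → ℕ) (hα : ∀ i, α i < N)
    (hα1 : t ≤ piMap N ρ α)
    (hα2 : ∀ y ∈ cantorE N ρ, t ≤ y → piMap N ρ α ≤ y) :
    dimH (Egamma N ρ t) = dimH (piMap N ρ '' Egamma' N α) := by
  have h := N_rho_lt hN hρ1
  have hρ := rho_lt_one hN hρ0 h
  apply le_antisymm
  · let F : (Σ k : ℕ, (Fin k → ℕ)) → ℝ → ℝ := fun w y =>
      R N ρ * ∑ i : Fin w.1, (w.2 i : ℝ) * ρ ^ (i : ℕ) + ρ ^ w.1 * y
    have hsub : Egamma N ρ t ⊆ ⋃ w, F w '' (piMap N ρ '' Egamma' N α) := by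
      rintro x ⟨d, hd, rfl, hl⟩
      rw [liminf_iff hN hρ0 h htE α d hd hα1 hα2] at hl
      obtain ⟨k, hk⟩ := eventually_atTop.1 hl
      refine mem_iUnion.2 ⟨⟨k, fun i => d i⟩, _, ⟨shiftSeq d k, ⟨fun i => hd _, fun n => ?_⟩, rfl⟩, ?_⟩
      · rw [cond_iff hN hρ0 h α (shiftSeq d k) hα (fun i => hd _) n, gam_shift]
        exact hk _ (by omega)
      · rw [piMap_split hρ0 hρ d hd k, Finset.sum_range]
    refine (dimH_mono hsub).trans ?_
    rw [dimH_iUnion]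
    refine iSup_le fun w => ?_
    have hL : LipschitzWith (Real.toNNReal (ρ ^ w.1)) (F w) := by
      refine LipschitzWith.of_dist_le_mul fun x y => ?_
      rw [Real.coe_toNNReal _ (by positivity), Real.dist_eq, Real.dist_eq]
      have : F w x - F w y = ρ ^ w.1 * (x - y) := by simp only [F]; ring
      rw [this, abs_mul, abs_of_pos (by positivity : 0 < ρ ^ w.1)]
    exact hL.dimH_image_le _
  · apply dimH_mono
    rintro x ⟨d, ⟨hd, hc⟩, rfl⟩
    refine ⟨d, hd, rfl, ?_⟩
    rw [liminf_iff hN hρ0 h htE α d hd hα1 hα2]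
    exact Eventually.of_forall fun n => (cond_iff hN hρ0 h α d hα hd n).1 (hc n)

end HomogeneousCantorDensity
end

section
/- For every n ∈ ℕ and every i with 0 ≤ i < 2^n, the words satisfy (λ_1…λ_{2^n−i})̄ ≺ λ_{i+1}…λ_{2^n} ≼ λ_1…λ_{2^n−i} in the lexicographical order, where w̄ denotes the reflection of the word w. -/
namespace HomogeneousCantorDensity

/-- strict lexicographic order on words of length `L` (given as functions). -/
def wordLT (L : ℕ) (a b : ℕ → ℕ) : Prop :=
  ∃ n < L, (∀ i < n, a i = b i) ∧ a n < b n

/-- lexicographic order on words of length `L` (given as functions). -/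
def wordLE (L : ℕ) (a b : ℕ → ℕ) : Prop :=
  wordLT L a b ∨ ∀ i < L, a i = b i

theorem lam_pow_bounds (N : ℕ) (hN : 2 ≤ N)
    (lam : ℕ → ℕ) (hlam1 : lam 1 = N - 1)
    (hlam3 : ∀ n : ℕ, lam (2 ^ (n + 1)) = N - lam (2 ^ n)) (n : ℕ) :
    1 ≤ lam (2 ^ n) ∧ lam (2 ^ n) ≤ N - 1 := by
  induction n with
  | zero => simp only [pow_zero, hlam1]; omega
  | succ n ih => rw [hlam3]; omega

theorem lam_le (N : ℕ) (hN : 2 ≤ N)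
    (lam : ℕ → ℕ) (hlam1 : lam 1 = N - 1)
    (hlam2 : ∀ n j : ℕ, 1 ≤ j → j < 2 ^ n → lam (2 ^ n + j) = N - 1 - lam j)
    (hlam3 : ∀ n : ℕ, lam (2 ^ (n + 1)) = N - lam (2 ^ n)) (n : ℕ) :
    ∀ j, 1 ≤ j → j ≤ 2 ^ n → lam j ≤ N - 1 := by
  induction n with
  | zero =>
    intro j h1 h2
    have : j = 1 := by simp at h2; omega
    subst this; omega
  | succ n ih =>
    intro j h1 h2
    have hb := (lam_pow_bounds N hN lam hlam1 hlam3 (n + 1)).2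
    by_cases h3 : j ≤ 2 ^ n
    · exact ih j h1 h3
    by_cases h4 : j = 2 ^ (n + 1)
    · rw [h4]; exact hb
    have h5 := hlam2 n (j - 2 ^ n) (by omega) (by rw [pow_succ] at *; omega)
    rw [show 2 ^ n + (j - 2 ^ n) = j by omega] at h5
    omega

theorem lam_words_aux (N : ℕ) (hN : 2 ≤ N)
    (lam : ℕ → ℕ) (hlam1 : lam 1 = N - 1)
    (hlam2 : ∀ n j : ℕ, 1 ≤ j → j < 2 ^ n → lam (2 ^ n + j) = N - 1 - lam j)
    (hlam3 : ∀ n : ℕ, lam (2 ^ (n + 1)) = N - lam (2 ^ n)) (n : ℕ) :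
    ∀ i : ℕ, i < 2 ^ n →
      wordLT (2 ^ n - i) (fun j => N - 1 - lam (1 + j)) (fun j => lam (i + 1 + j)) ∧
      wordLE (2 ^ n - i) (fun j => lam (i + 1 + j)) (fun j => lam (1 + j)) := by
  induction n with
  | zero =>
    intro i hi
    have : i = 0 := by simpa using hi
    subst this
    refine ⟨⟨0, by simp, by simp, ?_⟩, Or.inr (by simp)⟩
    simp only [Nat.add_zero, Nat.zero_add, hlam1]; omega
  | succ n ih =>
    intro i hi
    have hb := lam_pow_bounds N hN lam hlam1 hlam3 n
    have hle := lam_le N hN lam hlam1 hlam2 hlam3 n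
    have h3 := hlam3 n
    have h2 := hlam2 n
    have hp : 2 ^ (n + 1) = 2 * 2 ^ n := by ring
    rw [hp] at hi h3 ⊢
    generalize 2 ^ n = M at *
    clear hlam2 hlam3 hp
    by_cases hiM : i < M
    · obtain ⟨⟨m, hm, he, hl⟩, hU⟩ := ih i hiM
      refine ⟨⟨m, by omega, he, hl⟩, ?_⟩
      rcases hU with ⟨m', hm', he', hl'⟩ | hU
      · exact Or.inl ⟨m', by omega, he', hl'⟩
      rcases Nat.eq_zero_or_pos i with h0 | h0
      · subst h0; right; intro j _; simp
      obtain ⟨⟨p, hq, hpe, hpl⟩, -⟩ := ih (M - i) (by omega)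
      left
      simp only at hU hpe hpl
      refine ⟨M - i + p, by omega, ?_, ?_⟩
      · intro j hj
        by_cases hj' : j < M - i
        · exact hU j hj'
        · have a := hpe (j - (M - i)) (by omega)
          have b := h2 (1 + (j - (M - i))) (by omega) (by omega)
          simp only
          rw [show i + 1 + j = M + (1 + (j - (M - i))) by omega, b, a]
          congr 1; omega
      · have b := h2 (1 + p) (by omega) (by omega)
        simp only
        rw [show i + 1 + (M - i + p) = M + (1 + p) by omega, b,
          show 1 + (M - i + p) = M - i + 1 + p by omega]
        exact hpl
    · obtain ⟨k, rfl⟩ : ∃ k, i = M + k := ⟨i - M, by omega⟩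
      have hk : k < M := by omega
      obtain ⟨⟨m, hm, he, hl⟩, hU⟩ := ih k hk
      have hlen : 2 * M - (M + k) = M - k := by omega
      rw [hlen]
      have hbar : ∀ j, j + 1 < M - k → lam (M + k + 1 + j) = N - 1 - lam (k + 1 + j) := by
        intro j hj
        rw [show M + k + 1 + j = M + (k + 1 + j) by omega]
        exact h2 _ (by omega) (by omega)
      have hlast : ∀ j, j + 1 = M - k →
          lam (M + k + 1 + j) = N - lam (k + 1 + j) := by
        intro j hj
        rw [show M + k + 1 + j = 2 * M by omega, show k + 1 + j = M by omega]
        exact h3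
      have hA : ∀ j, j < M - k → lam (1 + j) ≤ N - 1 :=
        fun j hj => hle _ (by omega) (by omega)
      have hB : ∀ j, j < M - k → lam (k + 1 + j) ≤ N - 1 :=
        fun j hj => hle _ (by omega) (by omega)
      simp only [wordLT, wordLE] at he hl hU ⊢
      constructor
      · rcases hU with ⟨m', hm', he', hl'⟩ | hU
        · refine ⟨m', hm', ?_, ?_⟩
          · intro j hj
            rw [hbar j (by omega), he' j hj]
          · have := hA m' hm'
            have := hB m' hm'
            rcases Nat.lt_or_ge (m' + 1) (M - k) with h | h
            · rw [hbar m' h]; omega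
            · rw [hlast m' (by omega)]; omega
        · refine ⟨M - k - 1, by omega, ?_, ?_⟩
          · intro j hj
            rw [hbar j (by omega), hU j (by omega)]
          · have := hB (M - k - 1) (by omega)
            rw [hlast _ (by omega), ← hU _ (by omega)]; omega
      · clear hU
        have heq : ∀ j < m, lam (M + k + 1 + j) = lam (1 + j) := by
          intro j hj
          have := he j hj
          have := hA j (by omega)
          rw [hbar j (by omega)]; omega
        have := hA m hm
        have := hB m hm
        rcases Nat.lt_or_ge (m + 1) (M - k) with h | h
        · exact Or.inl ⟨m, hm, heq, by rw [hbar m h]; omega⟩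
        · have hv := hlast m (by omega)
          rcases Nat.lt_or_ge (lam (M + k + 1 + m)) (lam (1 + m)) with h' | h'
          · exact Or.inl ⟨m, hm, heq, h'⟩
          · right
            intro j hj
            rcases Nat.lt_or_ge j m with h'' | h''
            · exact heq j h''
            · have : j = m := by omega
              subst this; omega

/-- Lemma 3.3 (i): for every `n ≥ 1` and `0 ≤ i < 2^n`,
`reflection(λ_1…λ_{2^n-i}) ≺ λ_{i+1}…λ_{2^n} ≼ λ_1…λ_{2^n-i}`.
The word `λ_{i+1}…λ_{2^n}` of length `2^n - i` is `j ↦ lam (i+1+j)`. -/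
theorem lam_word_inequalities (N : ℕ) (hN : 2 ≤ N)
    (lam : ℕ → ℕ) (hlam1 : lam 1 = N - 1)
    (hlam2 : ∀ n j : ℕ, 1 ≤ j → j < 2 ^ n → lam (2 ^ n + j) = N - 1 - lam j)
    (hlam3 : ∀ n : ℕ, lam (2 ^ (n + 1)) = N - lam (2 ^ n)) :
    ∀ n : ℕ, 1 ≤ n → ∀ i : ℕ, i < 2 ^ n →
      wordLT (2 ^ n - i) (fun j => N - 1 - lam (1 + j)) (fun j => lam (i + 1 + j)) ∧
      wordLE (2 ^ n - i) (fun j => lam (i + 1 + j)) (fun j => lam (1 + j)) := by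
  intro n _
  exact lam_words_aux N hN lam hlam1 hlam2 hlam3 n

end HomogeneousCantorDensity
end

section
/- If λ_i ∈ {1,…,N−2} for some i ≥ 1, then λ_{i+1} ∈ {0, N−1}. -/
namespace HomogeneousCantorDensity

/-- Lemma 3.3 (ii): if `λ_i ∈ {1,…,N-2}` for some `i ≥ 1`, then `λ_{i+1} ∈ {0, N-1}`. -/
theorem lam_succ_extreme (N : ℕ) (hN : 2 ≤ N)
    (lam : ℕ → ℕ) (hlam1 : lam 1 = N - 1)
    (hlam2 : ∀ n j : ℕ, 1 ≤ j → j < 2 ^ n → lam (2 ^ n + j) = N - 1 - lam j)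
    (hlam3 : ∀ n : ℕ, lam (2 ^ (n + 1)) = N - lam (2 ^ n)) :
    ∀ i : ℕ, 1 ≤ i → 1 ≤ lam i → lam i ≤ N - 2 →
      lam (i + 1) = 0 ∨ lam (i + 1) = N - 1 := by
  have key : ∀ i : ℕ, i % 2 = 1 → lam i = 0 ∨ lam i = N - 1 := by
    intro i
    induction i using Nat.strong_induction_on with
    | _ i ih =>
      intro hi
      by_cases h1 : i = 1
      · right; rw [h1, hlam1]
      · have hle : 2 ^ Nat.log 2 i ≤ i := Nat.pow_log_le_self 2 (by omega)
        have hlt : i < 2 ^ (Nat.log 2 i + 1) := Nat.lt_pow_succ_log_self (by norm_num) i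
        have hpos : Nat.log 2 i ≠ 0 := by
          intro h0
          rw [h0] at hlt
          omega
        obtain ⟨m, hm⟩ := Nat.exists_eq_succ_of_ne_zero hpos
        have heven : 2 ^ Nat.log 2 i = 2 * 2 ^ m := by rw [hm, pow_succ, mul_comm]
        have hp : 0 < 2 ^ m := by positivity
        have hs : 2 ^ (Nat.log 2 i + 1) = 2 * 2 ^ Nat.log 2 i := by rw [pow_succ, mul_comm]
        have h2 := hlam2 (Nat.log 2 i) (i - 2 ^ Nat.log 2 i) (by omega) (by omega)
        rw [Nat.add_sub_cancel' hle] at h2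
        have h3 := ih (i - 2 ^ Nat.log 2 i) (by omega) (by omega)
        omega
  intro i hi h1 h2
  rcases Nat.mod_two_eq_zero_or_one i with h | h
  · exact key (i + 1) (by omega)
  · have := key i h
    omega

end HomogeneousCantorDensity
end

section
/- For every n ∈ ℕ and every i with 0 ≤ i < 2^n, the words satisfy θ_2…θ_{2^n−i+1} ≼ θ_{i+2}…θ_{2^n+1} ≺ (θ_2…θ_{2^n−i+1})̄ in the lexicographical order, where w̄ denotes the reflection of the word w. -/
namespace HomogeneousCantorDensity

theorem theta_aux (M : ℕ) (hM : 1 ≤ M) (b : ℕ → ℕ)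
    (hv : ∀ j, b j = 0 ∨ b j = M)
    (h0 : ∀ n, b (2 ^ n - 1) = 0)
    (hr : ∀ n j, j + 1 < 2 ^ n → b (2 ^ n + j) = M - b j) :
    ∀ n : ℕ, ∀ i : ℕ, i < 2 ^ n →
      wordLE (2 ^ n - i) b (fun j => b (i + j)) ∧
      wordLT (2 ^ n - i) (fun j => b (i + j)) (fun j => M - b j) := by
  intro n
  induction n with
  | zero =>
    intro i hi
    have hi0 : i = 0 := by simpa using hi
    subst hi0
    have hb := h0 0
    simp only [pow_zero, Nat.sub_self] at hb
    refine ⟨Or.inr (fun j _ => by simp), 0, by simp, by simp, ?_⟩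
    simp [hb]; omega
  | succ n ih =>
    intro i hi
    have hp : 2 ^ (n + 1) = 2 ^ n + 2 ^ n := by ring
    have hr' := hr n
    have h0n := h0 n
    have h0s := h0 (n + 1)
    rw [hp] at hi h0s ⊢
    generalize 2 ^ n = P at *
    by_cases hiP : i < P
    · obtain ⟨hle, m, hm, heq, hlt⟩ := ih i hiP
      refine ⟨?_, m, by omega, heq, hlt⟩
      rcases hle with ⟨m', hm', heq', hlt'⟩ | hall
      · exact Or.inl ⟨m', by omega, heq', hlt'⟩
      · rcases Nat.eq_zero_or_pos i with rfl | hipos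
        · exact Or.inr (fun j _ => by simp)
        · obtain ⟨-, q, hq, hqe, hql⟩ := ih (P - i) (by omega)
          refine Or.inl ⟨P - i + q, by omega, ?_, ?_⟩
          · intro j hj
            by_cases hjP : j < P - i
            · exact hall j hjP
            · have h1 := hqe (j - (P - i)) (by omega)
              have h2 := hr' (j - (P - i)) (by omega)
              simp only at h1 ⊢
              rw [show P - i + (j - (P - i)) = j by omega] at h1
              rw [show P + (j - (P - i)) = i + j by omega] at h2
              omega
          · have h2 := hr' q (by omega)
            simp only at hql ⊢
            rw [show i + (P - i + q) = P + q by omega]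
            omega
    · obtain ⟨k, rfl⟩ : ∃ k, i = P + k := ⟨i - P, by omega⟩
      have hk : k < P := by omega
      obtain ⟨hle, m, hm, heq, hlt⟩ := ih k hk
      have hL : P + P - (P + k) = P - k := by omega
      rw [hL]
      have hsh : ∀ j, j + 1 < P - k → b (P + k + j) = M - b (k + j) := by
        intro j hj
        have := hr' (k + j) (by omega)
        rwa [← Nat.add_assoc] at this
      have hlast : ∀ j, j + 1 = P - k → b (P + k + j) = 0 ∧ b (k + j) = 0 := by
        intro j hj
        rw [show P + k + j = P + P - 1 by omega, show k + j = P - 1 by omega]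
        exact ⟨h0s, h0n⟩
      simp only at heq hlt
      constructor
      · have hpre : ∀ j < m, b j = b (P + k + j) := by
          intro j hj
          have h1 := heq j hj
          have h2 := hsh j (by omega)
          have h3 := hv j
          omega
        by_cases hmL : m + 1 < P - k
        · refine Or.inl ⟨m, hm, hpre, ?_⟩
          have h2 := hsh m hmL
          simp only
          omega
        · refine Or.inr ?_
          intro j hj
          by_cases hjm : j < m
          · exact hpre j hjm
          · have hjm' : j = m := by omega
            subst hjm'
            have h1 := hlast j (by omega)
            have h3 := hv j
            simp only
            omega
      · rcases hle with ⟨q, hq, hqe, hql⟩ | hall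
        · simp only at hqe hql
          have hqL : q + 1 < P - k := by
            by_contra hcon
            have := hlast q (by omega)
            omega
          refine ⟨q, hq, ?_, ?_⟩
          · intro j hj
            have h1 := hqe j hj
            have h2 := hsh j (by omega)
            simp only
            omega
          · have h2 := hsh q hqL
            have h3 := hv (k + q)
            simp only
            omega
        · simp only at hall
          refine ⟨P - k - 1, by omega, ?_, ?_⟩
          · intro j hj
            have h1 := hall j (by omega)
            have h2 := hsh j (by omega)
            simp only
            omega
          · have h1 := hall (P - k - 1) (by omega)
            have h2 := hlast (P - k - 1) (by omega)
            simp only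
            omega

/-- Lemma 3.7: for every `n ≥ 1` and `0 ≤ i < 2^n`,
`θ_2…θ_{2^n-i+1} ≼ θ_{i+2}…θ_{2^n+1} ≺ reflection(θ_2…θ_{2^n-i+1})`.
The word `θ_{i+2}…θ_{2^n+1}` of length `2^n - i` is `j ↦ th (i+2+j)`. -/
theorem theta_word_inequalities (N : ℕ) (hN : 2 ≤ N)
    (th : ℕ → ℕ) (hth1 : th 1 = N - 1)
    (hth2 : ∀ n j : ℕ, 1 ≤ j → j ≤ 2 ^ n → th (2 ^ n + j) = N - 1 - th j) :
    ∀ n : ℕ, 1 ≤ n → ∀ i : ℕ, i < 2 ^ n →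
      wordLE (2 ^ n - i) (fun j => th (2 + j)) (fun j => th (i + 2 + j)) ∧
      wordLT (2 ^ n - i) (fun j => th (i + 2 + j)) (fun j => N - 1 - th (2 + j)) := by
  intro n _ i hi
  have hval : ∀ n j, 1 ≤ j → j ≤ 2 ^ n → th j = 0 ∨ th j = N - 1 := by
    intro n
    induction n with
    | zero =>
      intro j h1 h2
      have : j = 1 := by simp at h2; omega
      subst this
      exact Or.inr hth1
    | succ n ih =>
      intro j h1 h2
      by_cases hj : j ≤ 2 ^ n
      · exact ih j h1 hj
      · have hp : 2 ^ (n + 1) = 2 ^ n + 2 ^ n := by ring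
        have h3 := hth2 n (j - 2 ^ n) (by omega) (by omega)
        have h4 := ih (j - 2 ^ n) (by omega) (by omega)
        rw [show 2 ^ n + (j - 2 ^ n) = j by omega] at h3
        omega
  have key := theta_aux (N - 1) (by omega) (fun j => th (2 + j))
    (fun j => hval (2 + j) (2 + j) (by omega) Nat.lt_two_pow_self.le)
    (fun n => by
      have h := hth2 n 1 le_rfl Nat.one_le_two_pow
      have hpos : 1 ≤ 2 ^ n := Nat.one_le_two_pow
      rw [show 2 + (2 ^ n - 1) = 2 ^ n + 1 by omega]
      omega)
    (fun n j hj => by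
      have h := hth2 n (2 + j) (by omega) (by omega)
      rw [← h]
      congr 1
      omega)
    n i hi
  have he : (fun j => th (i + 2 + j)) = fun j => th (2 + (i + j)) := by
    funext j
    congr 1
    omega
  rw [he]
  exact key

end HomogeneousCantorDensity
end
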